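/- arXiv:1605.07112 — 4 statements merged into one kernel-verified Lean document; each statement's English description precedes it below -/
import Mathlib

section
/- Let f : ℝ^N → ℝ be α-strongly convex and β-smooth with 0 < α ≤ β, let x* be the minimizer of f, and let 0 < η < 2/β. For any x ∈ ℝ^N, setting x⁺ = x − η∇f(x), one has ‖x⁺ − x*‖ ≤ λ ‖x − x*‖, where λ = max(|1 − ηα|, |1 − ηβ|). -/
open scoped BigOperators RealInnerProductSpace
open Filter

noncomputable section

abbrev Vec (N : ℕ) := EuclideanSpace ℝ (Fin N)

section SmoothStronglyConvex

variable {E : Type*} [NormedAddCommGroup E] [InnerProductSpace ℝ E]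

/-- The descent lemma: a function with Lipschitz gradient has a quadratic upper bound. -/
lemma le_add_inner_gradient_add_sq [CompleteSpace E] {f : E → ℝ} {β : ℝ}
    (hdiff : Differentiable ℝ f)
    (hsmooth : ∀ u v, ‖gradient f u - gradient f v‖ ≤ β * ‖u - v‖) (u v : E) :
    f v ≤ f u + ⟪gradient f u, v - u⟫ + β / 2 * ‖v - u‖ ^ 2 := by
  set d := v - u with hd
  let ψ : ℝ → ℝ := fun t => f (u + t • d) - t * ⟪gradient f u, d⟫ - β / 2 * ‖d‖ ^ 2 * t ^ 2
  have hψ (t : ℝ) : HasDerivAt ψ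
      (⟪gradient f (u + t • d), d⟫ - ⟪gradient f u, d⟫ - β * ‖d‖ ^ 2 * t) t := by
    have hline : HasDerivAt (fun t : ℝ => u + t • d) d t := by
      simpa using ((hasDerivAt_id t).smul_const d).const_add u
    have hf : HasDerivAt (fun t : ℝ => f (u + t • d)) ⟪gradient f (u + t • d), d⟫ t := by
      simpa [Function.comp_def] using
        (hdiff (u + t • d)).hasGradientAt.hasFDerivAt.comp_hasDerivAt t hline
    have hlin : HasDerivAt (fun t : ℝ => t * ⟪gradient f u, d⟫) ⟪gradient f u, d⟫ t := by
      simpa using (hasDerivAt_id t).mul_const ⟪gradient f u, d⟫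
    have hsq : HasDerivAt (fun t : ℝ => β / 2 * ‖d‖ ^ 2 * t ^ 2)
        (β / 2 * ‖d‖ ^ 2 * (2 * t)) t := by
      simpa using (hasDerivAt_pow 2 t).const_mul (β / 2 * ‖d‖ ^ 2)
    refine ((hf.sub hlin).sub hsq).congr_deriv ?_
    ring
  have hanti : AntitoneOn ψ (Set.Ici 0) := by
    refine antitoneOn_of_deriv_nonpos (convex_Ici 0)
      (fun t _ => (hψ t).continuousAt.continuousWithinAt)
      (fun t _ => (hψ t).differentiableAt.differentiableWithinAt) fun t ht => ?_
    rw [interior_Ici, Set.mem_Ioi] at ht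
    have hlip : ‖gradient f (u + t • d) - gradient f u‖ ≤ β * (t * ‖d‖) := by
      simpa [norm_smul, abs_of_pos ht] using hsmooth (u + t • d) u
    have hcs := real_inner_le_norm (gradient f (u + t • d) - gradient f u) d
    have hmul := mul_le_mul_of_nonneg_right hlip (norm_nonneg d)
    rw [inner_sub_left] at hcs
    rw [(hψ t).deriv]
    linarith
  have h01 : ψ 1 ≤ ψ 0 := hanti Set.self_mem_Ici (Set.mem_Ici.2 zero_le_one) zero_le_one
  simp only [ψ, one_smul, zero_smul, add_zero, hd, add_sub_cancel] at h01
  linarith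

/-- Sharpened lower bound for a function with quadratic lower and upper bounds. -/
lemma sq_norm_sub_smul_le_of_quadratic_bounds {f : E → ℝ} {g : E → E} {α β : ℝ} (hαβ : α < β)
    (hlower : ∀ u v, f u + ⟪g u, v - u⟫ + α / 2 * ‖v - u‖ ^ 2 ≤ f v)
    (hupper : ∀ u v, f v ≤ f u + ⟪g u, v - u⟫ + β / 2 * ‖v - u‖ ^ 2) (u v : E) :
    ‖g u - g v - α • (u - v)‖ ^ 2 ≤
      2 * (β - α) * (f u - f v - ⟪g v, u - v⟫ - α / 2 * ‖u - v‖ ^ 2) := by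
  set q := g u - g v - α • (u - v) with hq
  set t := (β - α)⁻¹
  have hL : 0 < β - α := sub_pos.2 hαβ
  have ht : (β - α) * t = 1 := mul_inv_cancel₀ hL.ne'
  have h1 := hlower v (u - t • q)
  have h2 := hupper u (u - t • q)
  rw [sub_right_comm] at h1
  rw [sub_sub_cancel_left, norm_neg, norm_smul, mul_pow, Real.norm_eq_abs, sq_abs,
    inner_neg_right, inner_smul_right] at h2
  rw [norm_sub_sq_real, norm_smul, mul_pow, Real.norm_eq_abs, sq_abs, inner_sub_right,
    inner_smul_right, inner_smul_right] at h1
  have h3 : ‖q‖ ^ 2 = ⟪g u, q⟫ - ⟪g v, q⟫ - α * ⟪u - v, q⟫ := by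
    rw [← real_inner_self_eq_norm_sq]
    nth_rewrite 1 [hq]
    rw [inner_sub_left, inner_sub_left, real_inner_smul_left]
  have h4 : t / 2 * ‖q‖ ^ 2 ≤ f u - f v - ⟪g v, u - v⟫ - α / 2 * ‖u - v‖ ^ 2 := by
    have h5 : (β - α) * t ^ 2 * ‖q‖ ^ 2 = t * ‖q‖ ^ 2 := by
      rw [pow_two t, ← mul_assoc, ht, one_mul]
    have h6 := congrArg (t * ·) h3
    linarith
  calc ‖q‖ ^ 2 = 2 * (β - α) * (t / 2 * ‖q‖ ^ 2) := by linear_combination -‖q‖ ^ 2 * ht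
    _ ≤ _ := by gcongr

/-- Strengthened co-coercivity of the gradient of a smooth strongly convex function. -/
lemma sq_norm_add_le_inner_of_quadratic_bounds {f : E → ℝ} {g : E → E} {α β : ℝ} (hαβ : α < β)
    (hlower : ∀ u v, f u + ⟪g u, v - u⟫ + α / 2 * ‖v - u‖ ^ 2 ≤ f v)
    (hupper : ∀ u v, f v ≤ f u + ⟪g u, v - u⟫ + β / 2 * ‖v - u‖ ^ 2) (u v : E) :
    ‖g u - g v‖ ^ 2 + α * β * ‖u - v‖ ^ 2 ≤ (α + β) * ⟪g u - g v, u - v⟫ := by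
  have h1 := sq_norm_sub_smul_le_of_quadratic_bounds hαβ hlower hupper u v
  have h2 := sq_norm_sub_smul_le_of_quadratic_bounds hαβ hlower hupper v u
  have hswap : g v - g u - α • (v - u) = -(g u - g v - α • (u - v)) := by module
  rw [hswap, norm_neg, ← neg_sub u v, inner_neg_right, norm_neg] at h2
  have h3 : ‖g u - g v - α • (u - v)‖ ^ 2 =
      ‖g u - g v‖ ^ 2 - 2 * (α * ⟪g u - g v, u - v⟫) + α ^ 2 * ‖u - v‖ ^ 2 := by
    rw [norm_sub_sq_real, inner_smul_right, norm_smul, mul_pow, Real.norm_eq_abs, sq_abs]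
  have h4 : ⟪g u - g v, u - v⟫ = ⟪g u, u - v⟫ - ⟪g v, u - v⟫ := inner_sub_left _ _ _
  rw [h3] at h1 h2
  rw [h4] at h1 h2 ⊢
  linarith

/-- The gradient of a strongly convex function is strongly monotone. -/
lemma mul_sq_norm_le_inner_of_quadratic_lower_bound {f : E → ℝ} {g : E → E} {α : ℝ}
    (hlower : ∀ u v, f u + ⟪g u, v - u⟫ + α / 2 * ‖v - u‖ ^ 2 ≤ f v) (u v : E) :
    α * ‖u - v‖ ^ 2 ≤ ⟪g u - g v, u - v⟫ := by
  have h1 := hlower u v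
  have h2 := hlower v u
  rw [← neg_sub u v, inner_neg_right, norm_neg] at h1
  rw [inner_sub_left]
  linarith

/-- A gradient step contracts distances by the factor `max |1 - η * α| |1 - η * β|`. -/
lemma norm_sub_smul_gradient_sub_le [CompleteSpace E] {f : E → ℝ} {α β η : ℝ}
    (hαβ : α ≤ β) (hη : 0 ≤ η) (hdiff : Differentiable ℝ f)
    (hstr : ∀ u v, f u + ⟪gradient f u, v - u⟫ + α / 2 * ‖v - u‖ ^ 2 ≤ f v)
    (hsmooth : ∀ u v, ‖gradient f u - gradient f v‖ ≤ β * ‖u - v‖) (u v : E) :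
    ‖(u - η • gradient f u) - (v - η • gradient f v)‖ ≤
      max |1 - η * α| |1 - η * β| * ‖u - v‖ := by
  set G := gradient f u - gradient f v with hG
  set D := u - v with hD
  have hmono : α * ‖D‖ ^ 2 ≤ ⟪G, D⟫ := mul_sq_norm_le_inner_of_quadratic_lower_bound hstr u v
  have hlip : ‖G‖ ≤ β * ‖D‖ := hsmooth u v
  have hexp : ‖D - η • G‖ ^ 2 = ‖D‖ ^ 2 - 2 * η * ⟪G, D⟫ + η ^ 2 * ‖G‖ ^ 2 := by
    rw [norm_sub_sq_real, inner_smul_right, norm_smul, mul_pow, Real.norm_eq_abs, sq_abs,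
      real_inner_comm]
    ring
  have hstep : (u - η • gradient f u) - (v - η • gradient f v) = D - η • G := by
    rw [hG, hD]
    module
  have hcase : ‖D - η • G‖ ^ 2 ≤ (|1 - η * α| * ‖D‖) ^ 2 ∨
      ‖D - η • G‖ ^ 2 ≤ (|1 - η * β| * ‖D‖) ^ 2 := by
    rw [mul_pow, mul_pow, sq_abs, sq_abs, hexp]
    rcases hαβ.eq_or_lt with rfl | hlt
    · left
      have h1 : ‖G‖ ^ 2 ≤ (α * ‖D‖) ^ 2 := by gcongr
      have h2 := mul_le_mul_of_nonneg_left h1 (sq_nonneg η)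
      have h3 := mul_le_mul_of_nonneg_left hmono hη
      linarith
    · have hcoer : ‖G‖ ^ 2 + α * β * ‖D‖ ^ 2 ≤ (α + β) * ⟪G, D⟫ :=
        sq_norm_add_le_inner_of_quadratic_bounds hlt hstr
          (le_add_inner_gradient_add_sq hdiff hsmooth) u v
      have h1 := mul_le_mul_of_nonneg_left hcoer (sq_nonneg η)
      rcases le_total (η * (α + β)) 2 with h | h
      · left
        have h2 := mul_le_mul_of_nonneg_left hmono (mul_nonneg hη (sub_nonneg.2 h))
        linarith
      · right
        have hupp : ⟪G, D⟫ ≤ β * ‖D‖ ^ 2 := by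
          have := mul_le_mul_of_nonneg_right hlip (norm_nonneg D)
          linarith [real_inner_le_norm G D]
        have h2 := mul_le_mul_of_nonneg_left hupp (mul_nonneg hη (sub_nonneg.2 h))
        linarith
  rw [hstep]
  rcases hcase with h | h
  · exact ((pow_le_pow_iff_left₀ (norm_nonneg _) (by positivity) two_ne_zero).1 h).trans
      (by gcongr; exact le_max_left _ _)
  · exact ((pow_le_pow_iff_left₀ (norm_nonneg _) (by positivity) two_ne_zero).1 h).trans
      (by gcongr; exact le_max_right _ _)

end SmoothStronglyConvex

theorem statement3
    {N : ℕ} (α β η : ℝ)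
    (hα : 0 < α) (hαβ : α ≤ β)
    (hη0 : 0 < η) (hη1 : η < 2 / β)
    (f : Vec N → ℝ)
    (hdiff : Differentiable ℝ f)
    (hstr : ∀ u v : Vec N,
      f u + ⟪gradient f u, v - u⟫ + α / 2 * ‖v - u‖ ^ 2 ≤ f v)
    (hsmooth : ∀ u v : Vec N, ‖gradient f u - gradient f v‖ ≤ β * ‖u - v‖)
    (xstar : Vec N) (hmin : ∀ z, f xstar ≤ f z)
    (x : Vec N) :
    ‖(x - η • gradient f x) - xstar‖ ≤
      max |1 - η * α| |1 - η * β| * ‖x - xstar‖ := by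
  have hgrad : gradient f xstar = 0 := by
    have hfd : fderiv ℝ f xstar = 0 :=
      IsLocalMin.fderiv_eq_zero (Filter.Eventually.of_forall hmin)
    rw [gradient, hfd, map_zero]
  simpa [hgrad] using norm_sub_smul_gradient_sub_le hαβ hη0.le hdiff hstr hsmooth x xstar
end
end

section
/- For the distributed gradient-tracking algorithm with each f_i convex and β-smooth (β > 0) and step size 0 < η ≤ (1−σ)²/(160β), define A₁ = (1/β)‖s(0) − 𝟙g(0)‖ + 2‖x(0) − 𝟙x̄(0)‖, A₂ = η√n, and θ = (1+σ)/2. Then for every k ≥ 0 the consensus error satisfies ‖x(k) − 𝟙x̄(k)‖ ≤ A₁ θ^k + A₂ Σ_{ℓ=0}^{k−1} θ^{k−1−ℓ} ‖g(ℓ)‖. -/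
open scoped BigOperators RealInnerProductSpace
open Filter

noncomputable section

/-- Frobenius norm of a stacked matrix in `ℝ^{n×N}`, viewed as `n` rows in `ℝ^N`. -/
def fro {n N : ℕ} (A : Fin n → Vec N) : ℝ := Real.sqrt (∑ i, ‖A i‖ ^ 2)

/-- Spectral norm (largest singular value) of a square real matrix, as the operator norm
of the induced linear map between Euclidean spaces. -/
def specNorm {n : ℕ} (M : Matrix (Fin n) (Fin n) ℝ) : ℝ :=
  ‖LinearMap.toContinuousLinearMap (Matrix.toEuclideanLin M)‖

/-- The average of the rows of a stacked matrix. -/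
def avg {n N : ℕ} (A : Fin n → Vec N) : Vec N := (n : ℝ)⁻¹ • ∑ i, A i

/-- The rows of the product of a square matrix with a stacked matrix. -/
def mix {n N : ℕ} (M : Matrix (Fin n) (Fin n) ℝ) (A : Fin n → Vec N) : Fin n → Vec N :=
  fun i => ∑ j, M i j • A j

lemma fro_eq_norm {n N : ℕ} (A : Fin n → Vec N) : fro A = ‖WithLp.toLp 2 A‖ := by
  rw [PiLp.norm_eq_of_L2, fro]

lemma fro_nonneg {n N : ℕ} (A : Fin n → Vec N) : 0 ≤ fro A := Real.sqrt_nonneg _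

lemma fro_sq {n N : ℕ} (A : Fin n → Vec N) : fro A ^ 2 = ∑ i, ‖A i‖ ^ 2 :=
  Real.sq_sqrt (by positivity)

lemma fro_add_le {n N : ℕ} (A B : Fin n → Vec N) : fro (A + B) ≤ fro A + fro B := by
  simpa only [fro_eq_norm, WithLp.toLp_add] using norm_add_le _ _

lemma fro_sub_le {n N : ℕ} (A B : Fin n → Vec N) : fro (A - B) ≤ fro A + fro B := by
  simpa only [fro_eq_norm, WithLp.toLp_sub] using norm_sub_le _ _

lemma fro_smul {n N : ℕ} {c : ℝ} (hc : 0 ≤ c) (A : Fin n → Vec N) :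
    fro (c • A) = c * fro A := by
  rw [fro_eq_norm, fro_eq_norm, WithLp.toLp_smul, norm_smul, Real.norm_of_nonneg hc]

lemma fro_const {n N : ℕ} (v : Vec N) : fro (fun _ : Fin n => v) = √n * ‖v‖ := by
  simp [fro, Real.sqrt_mul]

lemma fro_le_mul_of_norm_le {n N : ℕ} {A B : Fin n → Vec N} {c : ℝ} (hc : 0 ≤ c)
    (h : ∀ i, ‖A i‖ ≤ c * ‖B i‖) : fro A ≤ c * fro B := by
  refine Real.sqrt_le_iff.mpr ⟨mul_nonneg hc (fro_nonneg B), ?_⟩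
  rw [mul_pow, fro_sq, Finset.mul_sum]
  refine Finset.sum_le_sum fun i _ => ?_
  rw [← mul_pow]
  exact pow_le_pow_left₀ (norm_nonneg _) (h i) 2

lemma fro_sq_eq_sum_columns {n N : ℕ} (A : Fin n → Vec N) :
    fro A ^ 2 = ∑ c, ‖(WithLp.toLp 2 fun i => A i c : EuclideanSpace ℝ (Fin n))‖ ^ 2 := by
  simp only [fro_sq, EuclideanSpace.norm_sq_eq]
  exact Finset.sum_comm

lemma specNorm_nonneg {n : ℕ} (M : Matrix (Fin n) (Fin n) ℝ) : 0 ≤ specNorm M := norm_nonneg _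

lemma fro_mix_le {n N : ℕ} (M : Matrix (Fin n) (Fin n) ℝ) (A : Fin n → Vec N) :
    fro (mix M A) ≤ specNorm M * fro A := by
  refine le_of_sq_le_sq ?_ (mul_nonneg (specNorm_nonneg M) (fro_nonneg A))
  rw [mul_pow, fro_sq_eq_sum_columns, fro_sq_eq_sum_columns, Finset.mul_sum]
  refine Finset.sum_le_sum fun c _ => ?_
  rw [← mul_pow]
  refine pow_le_pow_left₀ (norm_nonneg _) ?_ 2
  have hcol : (WithLp.toLp 2 fun i => mix M A i c : EuclideanSpace ℝ (Fin n)) =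
      LinearMap.toContinuousLinearMap (Matrix.toEuclideanLin M)
        (WithLp.toLp 2 fun i => A i c) := by
    ext i
    simp [mix, Matrix.mulVec, dotProduct]
  rw [hcol]
  exact ContinuousLinearMap.le_opNorm _ _

lemma sum_sub_avg {n N : ℕ} (hn : 0 < n) (A : Fin n → Vec N) : ∑ i, (A i - avg A) = 0 := by
  have : (n : ℝ) ≠ 0 := by positivity
  simp [avg, ← Nat.cast_smul_eq_nsmul ℝ, smul_smul, this]

lemma fro_sub_avg_le {n N : ℕ} (hn : 0 < n) (A : Fin n → Vec N) :
    fro (fun i => A i - avg A) ≤ fro A := by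
  refine le_of_sq_le_sq ?_ (fro_nonneg A)
  have hexp : ∀ i, ‖A i‖ ^ 2 =
      ‖A i - avg A‖ ^ 2 + 2 * inner ℝ (A i - avg A) (avg A) + ‖avg A‖ ^ 2 := fun i => by
    rw [← norm_add_sq_real, sub_add_cancel]
  rw [fro_sq, fro_sq, Finset.sum_congr rfl fun i _ => hexp i, Finset.sum_add_distrib,
    Finset.sum_add_distrib, ← Finset.mul_sum, ← sum_inner, sum_sub_avg hn, inner_zero_left]
  have : 0 ≤ ∑ _i : Fin n, ‖avg A‖ ^ 2 := by positivity
  linarith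

lemma avg_add {n N : ℕ} (A B : Fin n → Vec N) : avg (A + B) = avg A + avg B := by
  simp [avg, Finset.sum_add_distrib]

lemma avg_sub {n N : ℕ} (A B : Fin n → Vec N) : avg (A - B) = avg A - avg B := by
  simp [avg, smul_sub]

lemma avg_smul {n N : ℕ} (c : ℝ) (A : Fin n → Vec N) : avg (c • A) = c • avg A := by
  simp [avg, ← Finset.smul_sum, smul_comm c]

lemma avg_mix {n N : ℕ} {W : Matrix (Fin n) (Fin n) ℝ} (hWcol : ∀ j, ∑ i, W i j = 1)
    (A : Fin n → Vec N) : avg (mix W A) = avg A := by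
  simp only [avg, mix]
  rw [Finset.sum_comm]
  simp [← Finset.sum_smul, hWcol]

lemma fro_mix_sub_avg_le {n N : ℕ} (hn : 0 < n) {W : Matrix (Fin n) (Fin n) ℝ}
    (hWrow : ∀ i, ∑ j, W i j = 1) (A : Fin n → Vec N) :
    fro (fun i => mix W A i - avg A) ≤
      specNorm (W - (n : ℝ)⁻¹ • Matrix.of (fun _ _ => (1 : ℝ))) *
        fro (fun i => A i - avg A) := by
  refine (le_of_eq ?_).trans (fro_mix_le _ _)
  congr 1
  funext i
  have hW : ∑ j, W i j • (A j - avg A) = ∑ j, W i j • A j - avg A := by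
    simp only [smul_sub, Finset.sum_sub_distrib, ← Finset.sum_smul, hWrow, one_smul]
  simp only [mix, Matrix.sub_apply, Matrix.smul_apply, Matrix.of_apply, smul_eq_mul, mul_one]
  simp_rw [sub_smul]
  rw [Finset.sum_sub_distrib, hW, ← Finset.smul_sum, sum_sub_avg hn, smul_zero, sub_zero]

lemma le_geometric_convolution {V b : ℕ → ℝ} {θ : ℝ} (hθ : 0 ≤ θ)
    (h : ∀ t, V (t + 1) ≤ θ * V t + b t) (k : ℕ) :
    V k ≤ V 0 * θ ^ k + ∑ l ∈ Finset.range k, θ ^ (k - 1 - l) * b l := by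
  induction k with
  | zero => simp
  | succ k ih =>
    have hsum : ∑ l ∈ Finset.range (k + 1), θ ^ (k + 1 - 1 - l) * b l
        = θ * ∑ l ∈ Finset.range k, θ ^ (k - 1 - l) * b l + b k := by
      rw [Finset.sum_range_succ, Finset.mul_sum]
      congr 1
      · refine Finset.sum_congr rfl fun l hl => ?_
        rw [← mul_assoc, ← pow_succ']
        congr 2
        have := Finset.mem_range.mp hl
        omega
      · simp
    rw [hsum, pow_succ]
    linarith [h k, mul_le_mul_of_nonneg_left ih hθ]

/-- A coupled pair of recursions whose matrix is contracted with rate `(1 + σ) / 2` by the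
weighted sum `X + (1 - σ) / 4 * Y`. -/
lemma coupled_recursion_bound {X Y b : ℕ → ℝ} {σ e : ℝ} (hσ0 : 0 < σ) (hσ1 : σ < 1)
    (he : e ≤ (1 - σ) ^ 2 / 160) (hX0 : ∀ t, 0 ≤ X t) (hY0 : ∀ t, 0 ≤ Y t)
    (hb : ∀ t, 0 ≤ b t) (hX : ∀ t, X (t + 1) ≤ σ * X t + e * Y t)
    (hY : ∀ t, Y (t + 1) ≤ (σ + e) * Y t + 2 * X t + b t) (k : ℕ) :
    X k ≤ (Y 0 + 2 * X 0) * ((1 + σ) / 2) ^ k +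
      ∑ l ∈ Finset.range k, ((1 + σ) / 2) ^ (k - 1 - l) * b l := by
  have hc : 0 ≤ (1 - σ) / 4 := by linarith
  have hc1 : (1 - σ) / 4 ≤ 1 := by linarith
  have hθ : 0 ≤ (1 + σ) / 2 := by linarith
  have hstep : ∀ t, X (t + 1) + (1 - σ) / 4 * Y (t + 1) ≤
      (1 + σ) / 2 * (X t + (1 - σ) / 4 * Y t) + b t := fun t => by
    have hcoef : e * (1 + (1 - σ) / 4) ≤ (1 - σ) / 4 * ((1 - σ) / 2) := by
      nlinarith [sq_nonneg (1 - σ),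
        mul_le_mul_of_nonneg_right he (by linarith : 0 ≤ 1 + (1 - σ) / 4)]
    linarith [hX t, mul_le_mul_of_nonneg_left (hY t) hc, mul_le_mul_of_nonneg_right hcoef (hY0 t),
      mul_le_mul_of_nonneg_right hc1 (hb t)]
  have hV := le_geometric_convolution (V := fun t => X t + (1 - σ) / 4 * Y t) hθ hstep k
  have hV0 : X 0 + (1 - σ) / 4 * Y 0 ≤ Y 0 + 2 * X 0 := by
    linarith [hX0 0, mul_le_mul_of_nonneg_right hc1 (hY0 0)]
  have := mul_le_mul_of_nonneg_right hV0 (pow_nonneg hθ k)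
  have := mul_nonneg hc (hY0 k)
  linarith

theorem statement4
    {n N : ℕ} (hn : 0 < n)
    (β : ℝ) (hβ : 0 < β)
    (f : Fin n → Vec N → ℝ)
    (hcvx : ∀ i, ConvexOn ℝ Set.univ (f i))
    (hdiff : ∀ i, Differentiable ℝ (f i))
    (hsmooth : ∀ i, ∀ u v : Vec N,
      ‖gradient (f i) u - gradient (f i) v‖ ≤ β * ‖u - v‖)
    (W : Matrix (Fin n) (Fin n) ℝ)
    (hWnonneg : ∀ i j, 0 ≤ W i j)
    (hWrow : ∀ i, ∑ j, W i j = 1)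
    (hWcol : ∀ j, ∑ i, W i j = 1)
    (σ : ℝ)
    (hσ : σ = specNorm (W - (n : ℝ)⁻¹ • Matrix.of (fun _ _ => (1 : ℝ))))
    (hσ0 : 0 < σ) (hσ1 : σ < 1)
    (η : ℝ) (hη0 : 0 < η) (hη1 : η ≤ (1 - σ) ^ 2 / (160 * β))
    (x s : ℕ → Fin n → Vec N)
    (hs0 : ∀ i, s 0 i = gradient (f i) (x 0 i))
    (hxupd : ∀ t i, x (t + 1) i = (∑ j, W i j • x t j) - η • s t i)
    (hsupd : ∀ t i, s (t + 1) i =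
      (∑ j, W i j • s t j) + gradient (f i) (x (t + 1) i) - gradient (f i) (x t i))
    (xbar g : ℕ → Vec N)
    (hxbar : ∀ t, xbar t = (n : ℝ)⁻¹ • ∑ i, x t i)
    (hg : ∀ t, g t = (n : ℝ)⁻¹ • ∑ i, gradient (f i) (x t i))
    (A₁ A₂ θ : ℝ)
    (hA₁ : A₁ = (1 / β) * fro (fun i => s 0 i - g 0)
      + 2 * fro (fun i => x 0 i - xbar 0))
    (hA₂ : A₂ = η * Real.sqrt n)
    (hθ : θ = (1 + σ) / 2) :
    ∀ k : ℕ,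
      fro (fun i => x k i - xbar k) ≤
        A₁ * θ ^ k + A₂ * ∑ l ∈ Finset.range k, θ ^ (k - 1 - l) * ‖g l‖ := by
  have hxbar' : ∀ t, xbar t = avg (x t) := hxbar
  have hx : ∀ t, x (t + 1) = mix W (x t) - η • s t := fun t => funext (hxupd t)
  set D : ℕ → Fin n → Vec N := fun t i => gradient (f i) (x t i)
  have hgD : ∀ t, g t = avg (D t) := hg
  have hs : ∀ t, s (t + 1) = mix W (s t) + (D (t + 1) - D t) := fun t =>
    funext fun i => (hsupd t i).trans (add_sub_assoc _ _ _)
  have hsavg : ∀ t, avg (s t) = g t := fun t => by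
    induction t with
    | zero => rw [hgD, show s 0 = D 0 from funext hs0]
    | succ t ih => rw [hs, avg_add, avg_mix hWcol, avg_sub, ih, hgD, hgD, add_sub_cancel]
  set X : ℕ → ℝ := fun t => fro (fun i => x t i - xbar t) with hXdef
  set S : ℕ → ℝ := fun t => fro (fun i => s t i - g t) with hSdef
  have hmixx : ∀ t, fro (fun i => mix W (x t) i - xbar t) ≤ σ * X t := fun t => by
    simpa only [hσ, hXdef, hxbar'] using fro_mix_sub_avg_le hn hWrow (x t)
  have hmixs : ∀ t, fro (fun i => mix W (s t) i - g t) ≤ σ * S t := fun t => by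
    simpa only [hσ, hSdef, hsavg] using fro_mix_sub_avg_le hn hWrow (s t)
  have hXrec : ∀ t, X (t + 1) ≤ σ * X t + η * S t := fun t => by
    have heq : (fun i => x (t + 1) i - xbar (t + 1)) =
        (fun i => mix W (x t) i - xbar t) - η • fun i => s t i - g t := by
      funext i
      rw [hxbar', hx, avg_sub, avg_mix hWcol, avg_smul, hsavg, hxbar']
      simp only [Pi.sub_apply, Pi.smul_apply, smul_sub]
      abel
    calc X (t + 1) ≤ _ := (congrArg fro heq).le.trans (fro_sub_le _ _)
      _ ≤ σ * X t + η * S t := by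
        rw [fro_smul hη0.le]
        exact add_le_add_left (hmixx t) _
  have hdx : ∀ t, fro (x (t + 1) - x t) ≤ 2 * X t + η * S t + η * √n * ‖g t‖ := fun t => by
    have heq : x (t + 1) - x t =
        ((fun i => mix W (x t) i - xbar t) - fun i => x t i - xbar t) -
          η • ((fun i => s t i - g t) + fun _ => g t) := by
      funext i
      simp only [hx, Pi.sub_apply, Pi.add_apply, Pi.smul_apply, sub_add_cancel]
      abel
    have h₁ := fro_sub_le ((fun i => mix W (x t) i - xbar t) - fun i => x t i - xbar t)
      (η • ((fun i => s t i - g t) + fun _ => g t))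
    have h₂ := fro_sub_le (fun i => mix W (x t) i - xbar t) (fun i => x t i - xbar t)
    have h₃ := mul_le_mul_of_nonneg_left
      (fro_add_le (fun i => s t i - g t) (fun _ => g t)) hη0.le
    rw [fro_smul hη0.le] at h₁
    rw [fro_const] at h₃
    have hσX : σ * X t ≤ 1 * X t := mul_le_mul_of_nonneg_right hσ1.le (fro_nonneg _)
    rw [heq]
    linarith [hmixx t]
  have hSrec : ∀ t, S (t + 1) ≤ σ * S t + β * fro (x (t + 1) - x t) := fun t => by
    have heq : (fun i => s (t + 1) i - g (t + 1)) =
        (fun i => mix W (s t) i - g t) +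
          fun i => (D (t + 1) - D t) i - avg (D (t + 1) - D t) := by
      funext i
      rw [hs, avg_sub, ← hgD, ← hgD]
      simp only [Pi.add_apply]
      abel
    calc S (t + 1) ≤ _ := (congrArg fro heq).le.trans (fro_add_le _ _)
      _ ≤ σ * S t + β * fro (x (t + 1) - x t) :=
        add_le_add (hmixs t) ((fro_sub_avg_le hn _).trans
          (fro_le_mul_of_norm_le hβ.le fun i => hsmooth i _ _))
  have he : η * β ≤ (1 - σ) ^ 2 / 160 := by
    rw [le_div_iff₀ (by positivity)] at hη1 ⊢
    linarith
  intro k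
  have hbound := coupled_recursion_bound (X := X) (Y := fun t => 1 / β * S t)
    (b := fun t => η * √n * ‖g t‖) hσ0 hσ1 he (fun t => fro_nonneg _)
    (fun t => mul_nonneg (by positivity) (fro_nonneg _)) (fun t => by positivity)
    (fun t => (hXrec t).trans_eq (by field_simp))
    (fun t => by
      have h := (hSrec t).trans (add_le_add_right (mul_le_mul_of_nonneg_left (hdx t) hβ.le) _)
      calc 1 / β * S (t + 1) ≤ _ := mul_le_mul_of_nonneg_left h (by positivity)
        _ = _ := by field_simp; ring) k
  refine hbound.trans_eq ?_
  rw [hA₁, hA₂, hθ, Finset.mul_sum]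
  congr 1
  exact Finset.sum_congr rfl fun l _ => mul_left_comm _ _ _
end
end

section
/- For the distributed gradient-tracking algorithm with each f_i α-strongly convex and β-smooth (0 < α ≤ β) and step size 0 < η < 2/β, letting x* be the unique minimizer of f and λ = max(|1 − ηα|, |1 − ηβ|), the average iterate satisfies, for every k ≥ 1: ‖x̄(k) − x*‖ ≤ λ ‖x̄(k−1) − x*‖ + η (β/√n) ‖x(k−1) − 𝟙x̄(k−1)‖. -/
open scoped BigOperators RealInnerProductSpace
open Filter

noncomputable section

section GradientDescent

variable {E : Type*} [NormedAddCommGroup E] [InnerProductSpace ℝ E]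

/-- The descent lemma for functions with Lipschitz gradient. -/
theorem le_quadratic_of_lipschitz_gradient [CompleteSpace E] {f : E → ℝ} {β : ℝ}
    (hf : Differentiable ℝ f)
    (hlip : ∀ u v, ‖gradient f u - gradient f v‖ ≤ β * ‖u - v‖) (u v : E) :
    f v ≤ f u + ⟪gradient f u, v - u⟫ + β / 2 * ‖v - u‖ ^ 2 := by
  set d := v - u with hd
  let φ : ℝ → ℝ := fun t => f (u + t • d) - t * ⟪gradient f u, d⟫ - t ^ 2 * (β / 2 * ‖d‖ ^ 2)
  have hφ : ∀ t, HasDerivAt φ (⟪gradient f (u + t • d), d⟫ - ⟪gradient f u, d⟫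
      - 2 * t * (β / 2 * ‖d‖ ^ 2)) t := by
    intro t
    have h1 : HasDerivAt (fun t : ℝ => u + t • d) d t := by
      simpa using ((hasDerivAt_id t).smul_const d).const_add u
    have h2 : HasDerivAt (fun t : ℝ => f (u + t • d)) ⟪gradient f (u + t • d), d⟫ t := by
      rw [inner_gradient_left]
      exact (hf (u + t • d)).hasFDerivAt.comp_hasDerivAt t h1
    have h3 := (hasDerivAt_id t).mul_const ⟪gradient f u, d⟫
    have h4 := (hasDerivAt_pow 2 t).mul_const (β / 2 * ‖d‖ ^ 2)
    exact ((h2.sub h3).sub h4).congr_deriv (by simp)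
  have hanti : AntitoneOn φ (Set.Icc 0 1) := by
    refine antitoneOn_of_deriv_nonpos (convex_Icc 0 1)
      (fun t _ => (hφ t).continuousAt.continuousWithinAt)
      (fun t _ => (hφ t).differentiableAt.differentiableWithinAt) fun t ht => ?_
    rw [interior_Icc] at ht
    rw [(hφ t).deriv, ← inner_sub_left]
    have h1 := real_inner_le_norm (gradient f (u + t • d) - gradient f u) d
    have h2 := hlip (u + t • d) u
    rw [add_sub_cancel_left, norm_smul, Real.norm_eq_abs, abs_of_pos ht.1] at h2
    nlinarith [mul_le_mul_of_nonneg_right h2 (norm_nonneg d)]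
  have h := hanti (Set.left_mem_Icc.2 zero_le_one) (Set.right_mem_Icc.2 zero_le_one) zero_le_one
  have hv : u + d = v := by simp [hd]
  simp only [φ, one_smul, zero_smul, hv, add_zero] at h
  linarith

variable {F : E → ℝ} {G : E → E} {α β : ℝ}

theorem bregman_lower_bound
    (hlow : ∀ u v, F u + ⟪G u, v - u⟫ + α / 2 * ‖v - u‖ ^ 2 ≤ F v)
    (hup : ∀ u v, F v ≤ F u + ⟪G u, v - u⟫ + β / 2 * ‖v - u‖ ^ 2) (u v : E) (t : ℝ) :
    F v + ⟪G v, u - v⟫ + α / 2 * ‖u - v‖ ^ 2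
      + (t - (β - α) / 2 * t ^ 2) * ‖G u - G v - α • (u - v)‖ ^ 2 ≤ F u := by
  set d := u - v with hd
  set D := G u - G v - α • d with hD
  have h1 := hlow v (u - t • D)
  have h2 := hup u (u - t • D)
  have e1 : u - t • D - v = d - t • D := by rw [hd]; abel
  have e2 : u - t • D - u = -(t • D) := by abel
  have e3 : G u = G v + (D + α • d) := by rw [hD]; abel
  rw [e1, norm_sub_sq_real] at h1
  rw [e2, norm_neg, e3] at h2
  simp only [inner_sub_right, inner_neg_right, inner_add_left, real_inner_smul_left,
    real_inner_smul_right, norm_smul, mul_pow, Real.norm_eq_abs, sq_abs,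
    real_inner_self_eq_norm_sq] at h1 h2
  linarith

theorem inner_sub_le_of_quadratic_upper
    (hup : ∀ u v, F v ≤ F u + ⟪G u, v - u⟫ + β / 2 * ‖v - u‖ ^ 2) (u v : E) :
    ⟪G u - G v, u - v⟫ ≤ β * ‖u - v‖ ^ 2 := by
  have h1 := hup u v
  have h2 := hup v u
  rw [← neg_sub u v, inner_neg_right, norm_neg] at h1
  rw [inner_sub_left]
  linarith

theorem le_inner_sub_of_quadratic_lower
    (hlow : ∀ u v, F u + ⟪G u, v - u⟫ + α / 2 * ‖v - u‖ ^ 2 ≤ F v) (u v : E) :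
    α * ‖u - v‖ ^ 2 ≤ ⟪G u - G v, u - v⟫ := by
  have h1 := hlow u v
  have h2 := hlow v u
  rw [← neg_sub u v, inner_neg_right, norm_neg] at h1
  rw [inner_sub_left]
  linarith

theorem norm_sq_add_le_inner_of_quadratic_bounds (hαβ : α ≤ β)
    (hlow : ∀ u v, F u + ⟪G u, v - u⟫ + α / 2 * ‖v - u‖ ^ 2 ≤ F v)
    (hup : ∀ u v, F v ≤ F u + ⟪G u, v - u⟫ + β / 2 * ‖v - u‖ ^ 2) (u v : E) :
    ‖G u - G v‖ ^ 2 + α * β * ‖u - v‖ ^ 2 ≤ (α + β) * ⟪G u - G v, u - v⟫ := by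
  have key : ∀ t : ℝ, (2 * t - (β - α) * t ^ 2) * ‖G u - G v - α • (u - v)‖ ^ 2
      ≤ ⟪G u - G v, u - v⟫ - α * ‖u - v‖ ^ 2 := by
    intro t
    have h1 := bregman_lower_bound hlow hup u v t
    have h2 := bregman_lower_bound hlow hup v u t
    have e : G v - G u - α • (v - u) = -(G u - G v - α • (u - v)) := by
      rw [← neg_sub u v, smul_neg]; abel
    rw [e, norm_neg, ← neg_sub u v, inner_neg_right, norm_neg] at h2
    rw [inner_sub_left]
    linarith
  have hexp : ‖G u - G v - α • (u - v)‖ ^ 2 = ‖G u - G v‖ ^ 2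
      - 2 * α * ⟪G u - G v, u - v⟫ + α ^ 2 * ‖u - v‖ ^ 2 := by
    rw [norm_sub_sq_real, real_inner_smul_right, norm_smul, mul_pow, Real.norm_eq_abs, sq_abs]
    ring
  have hinner := inner_sub_le_of_quadratic_upper hup u v
  rcases hαβ.eq_or_lt with h | h
  · have h1 := key 1
    rw [hexp] at h1
    subst h
    linarith
  · have hL : 0 < β - α := sub_pos.2 h
    have h1 := mul_le_mul_of_nonneg_left (key (β - α)⁻¹) hL.le
    have e : (β - α) * ((2 * (β - α)⁻¹ - (β - α) * (β - α)⁻¹ ^ 2)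
        * ‖G u - G v - α • (u - v)‖ ^ 2) = ‖G u - G v - α • (u - v)‖ ^ 2 := by
      field_simp
      ring
    rw [e, hexp] at h1
    linarith

/-- A gradient step contracts by the factor `max |1 - η * α| |1 - η * β|`. -/
theorem norm_gradient_step_sub_le (hαβ : α ≤ β) {η : ℝ} (hη : 0 ≤ η)
    (hlow : ∀ u v, F u + ⟪G u, v - u⟫ + α / 2 * ‖v - u‖ ^ 2 ≤ F v)
    (hup : ∀ u v, F v ≤ F u + ⟪G u, v - u⟫ + β / 2 * ‖v - u‖ ^ 2) (u v : E) :
    ‖(u - v) - η • (G u - G v)‖ ≤ max |1 - η * α| |1 - η * β| * ‖u - v‖ := by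
  have hco := norm_sq_add_le_inner_of_quadratic_bounds hαβ hlow hup u v
  have hle := inner_sub_le_of_quadratic_upper hup u v
  have hge := le_inner_sub_of_quadratic_lower hlow u v
  have hexp : ‖(u - v) - η • (G u - G v)‖ ^ 2 = ‖u - v‖ ^ 2
      - 2 * η * ⟪G u - G v, u - v⟫ + η ^ 2 * ‖G u - G v‖ ^ 2 := by
    rw [norm_sub_sq_real, real_inner_smul_right, norm_smul, mul_pow, Real.norm_eq_abs, sq_abs,
      real_inner_comm]
    ring
  have h2 := mul_le_mul_of_nonneg_left hco (sq_nonneg η)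
  have step : ∀ c, ‖(u - v) - η • (G u - G v)‖ ^ 2 ≤ (1 - η * c) ^ 2 * ‖u - v‖ ^ 2 →
      ‖(u - v) - η • (G u - G v)‖ ≤ |1 - η * c| * ‖u - v‖ := by
    intro c hc
    refine le_of_sq_le_sq ?_ (by positivity)
    rwa [mul_pow, sq_abs]
  rcases le_total (η * (α + β)) 2 with h | h
  · refine (step α ?_).trans (mul_le_mul_of_nonneg_right (le_max_left _ _) (norm_nonneg _))
    rw [hexp]
    have h3 := mul_le_mul_of_nonneg_left hge (mul_nonneg hη (sub_nonneg.2 h))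
    linarith
  · refine (step β ?_).trans (mul_le_mul_of_nonneg_right (le_max_right _ _) (norm_nonneg _))
    rw [hexp]
    have h3 := mul_le_mul_of_nonneg_left hle (mul_nonneg hη (sub_nonneg.2 h))
    linarith

theorem eq_zero_of_isMin_of_quadratic_upper (hβ : 0 < β) {x : E} (hmin : ∀ z, F x ≤ F z)
    (hup : ∀ u v, F v ≤ F u + ⟪G u, v - u⟫ + β / 2 * ‖v - u‖ ^ 2) : G x = 0 := by
  have h := (hmin (x - β⁻¹ • G x)).trans (hup x _)
  rw [sub_sub_cancel_left, inner_neg_right, norm_neg, real_inner_smul_right,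
    real_inner_self_eq_norm_sq, norm_smul, mul_pow, Real.norm_eq_abs, sq_abs] at h
  have e : β / 2 * (β⁻¹ ^ 2 * ‖G x‖ ^ 2) = β⁻¹ * ‖G x‖ ^ 2 / 2 := by field_simp
  rw [e] at h
  have h2 : β⁻¹ * ‖G x‖ ^ 2 ≤ 0 := by linarith
  have h3 : ‖G x‖ ^ 2 ≤ 0 := nonpos_of_mul_nonpos_right h2 (inv_pos.2 hβ)
  simpa using le_antisymm h3 (sq_nonneg _)

end GradientDescent

theorem sum_norm_le_sqrt_mul_fro {n N : ℕ} (A : Fin n → Vec N) :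
    ∑ i, ‖A i‖ ≤ Real.sqrt n * fro A := by
  rw [fro, ← Real.sqrt_mul (Nat.cast_nonneg n)]
  apply Real.le_sqrt_of_sq_le
  simpa using sq_sum_le_card_mul_sum_sq (s := Finset.univ) (f := fun i => ‖A i‖)

theorem sum_mixing_eq {n N : ℕ} {W : Matrix (Fin n) (Fin n) ℝ}
    (hWcol : ∀ j, ∑ i, W i j = 1) (y : Fin n → Vec N) :
    ∑ i, ∑ j, W i j • y j = ∑ j, y j := by
  rw [Finset.sum_comm]
  exact Finset.sum_congr rfl fun j _ => by rw [← Finset.sum_smul, hWcol, one_smul]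

theorem statement7
    {n N : ℕ} (hn : 0 < n)
    (α β : ℝ) (hα : 0 < α) (hαβ : α ≤ β)
    (f : Fin n → Vec N → ℝ)
    (hdiff : ∀ i, Differentiable ℝ (f i))
    (hstr : ∀ i, ∀ u v : Vec N,
      f i u + ⟪gradient (f i) u, v - u⟫ + α / 2 * ‖v - u‖ ^ 2 ≤ f i v)
    (hsmooth : ∀ i, ∀ u v : Vec N,
      ‖gradient (f i) u - gradient (f i) v‖ ≤ β * ‖u - v‖)
    (favg : Vec N → ℝ) (hfavg : ∀ z, favg z = (n : ℝ)⁻¹ * ∑ i, f i z)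
    (xstar : Vec N) (hmin : ∀ z, favg xstar ≤ favg z)
    (W : Matrix (Fin n) (Fin n) ℝ)
    (hWnonneg : ∀ i j, 0 ≤ W i j)
    (hWrow : ∀ i, ∑ j, W i j = 1)
    (hWcol : ∀ j, ∑ i, W i j = 1)
    (η : ℝ) (hη0 : 0 < η) (hη1 : η < 2 / β)
    (x s : ℕ → Fin n → Vec N)
    (hs0 : ∀ i, s 0 i = gradient (f i) (x 0 i))
    (hxupd : ∀ t i, x (t + 1) i = (∑ j, W i j • x t j) - η • s t i)
    (hsupd : ∀ t i, s (t + 1) i =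
      (∑ j, W i j • s t j) + gradient (f i) (x (t + 1) i) - gradient (f i) (x t i))
    (xbar : ℕ → Vec N)
    (hxbar : ∀ t, xbar t = (n : ℝ)⁻¹ • ∑ i, x t i)
    (lam : ℝ) (hlam : lam = max |1 - η * α| |1 - η * β|) :
    ∀ k : ℕ,
      ‖xbar (k + 1) - xstar‖ ≤
        lam * ‖xbar k - xstar‖ +
          η * (β / Real.sqrt n) * fro (fun i => x k i - xbar k) := by
  have hn' : (0 : ℝ) < n := Nat.cast_pos.2 hn
  have hβ : 0 < β := hα.trans_le hαβ
  let G : Vec N → Vec N := fun z => (n : ℝ)⁻¹ • ∑ i, gradient (f i) z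
  have havg : ∀ (u v : Vec N) (c : ℝ),
      favg u + ⟪G u, v - u⟫ + c / 2 * ‖v - u‖ ^ 2
        = (n : ℝ)⁻¹ * ∑ i, (f i u + ⟪gradient (f i) u, v - u⟫ + c / 2 * ‖v - u‖ ^ 2) := by
    intro u v c
    simp only [G, hfavg, real_inner_smul_left, sum_inner, Finset.sum_add_distrib,
      Finset.sum_const, Finset.card_univ, Fintype.card_fin, nsmul_eq_mul]
    field_simp
  have hlow : ∀ u v, favg u + ⟪G u, v - u⟫ + α / 2 * ‖v - u‖ ^ 2 ≤ favg v := by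
    intro u v
    rw [havg, hfavg v]
    gcongr with i
    exact hstr i u v
  have hup : ∀ u v, favg v ≤ favg u + ⟪G u, v - u⟫ + β / 2 * ‖v - u‖ ^ 2 := by
    intro u v
    rw [havg, hfavg v]
    gcongr with i
    exact le_quadratic_of_lipschitz_gradient (hdiff i) (hsmooth i) u v
  have hG : G xstar = 0 := eq_zero_of_isMin_of_quadratic_upper hβ hmin hup
  have hsum : ∀ t, ∑ i, s t i = ∑ i, gradient (f i) (x t i) := by
    intro t
    induction t with
    | zero => exact Finset.sum_congr rfl fun i _ => hs0 i
    | succ t ih =>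
      simp only [hsupd, Finset.sum_sub_distrib, Finset.sum_add_distrib, sum_mixing_eq hWcol, ih]
      abel
  intro k
  have hstep : xbar (k + 1) = xbar k - η • (n : ℝ)⁻¹ • ∑ i, gradient (f i) (x k i) := by
    rw [hxbar, hxbar, ← hsum, smul_comm η, ← smul_sub]
    simp only [hxupd, Finset.sum_sub_distrib, sum_mixing_eq hWcol, Finset.smul_sum]
  have hsplit : xbar (k + 1) - xstar = ((xbar k - xstar) - η • (G (xbar k) - G xstar))
      - η • (n : ℝ)⁻¹ • ∑ i, (gradient (f i) (x k i) - gradient (f i) (xbar k)) := by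
    rw [hstep, hG, Finset.sum_sub_distrib]
    simp only [G, smul_sub, sub_zero]
    abel
  have herr : ‖η • (n : ℝ)⁻¹ • ∑ i, (gradient (f i) (x k i) - gradient (f i) (xbar k))‖
      ≤ η * (β / Real.sqrt n) * fro (fun i => x k i - xbar k) := by
    rw [norm_smul, norm_smul, Real.norm_of_nonneg hη0.le, Real.norm_of_nonneg (by positivity)]
    calc η * ((n : ℝ)⁻¹ * ‖∑ i, (gradient (f i) (x k i) - gradient (f i) (xbar k))‖)
        ≤ η * ((n : ℝ)⁻¹ * ∑ i, β * ‖x k i - xbar k‖) := by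
          gcongr
          exact norm_sum_le_of_le _ fun i _ => hsmooth i _ _
      _ ≤ η * ((n : ℝ)⁻¹ * (β * (Real.sqrt n * fro (fun i => x k i - xbar k)))) := by
          rw [← Finset.mul_sum]
          gcongr
          exact sum_norm_le_sqrt_mul_fro fun i => x k i - xbar k
      _ = η * (β / Real.sqrt n) * fro (fun i => x k i - xbar k) := by
          have hs : Real.sqrt n ≠ 0 := (Real.sqrt_pos.2 hn').ne'
          have e : (n : ℝ)⁻¹ = (Real.sqrt n)⁻¹ * (Real.sqrt n)⁻¹ := by
            rw [← mul_inv, Real.mul_self_sqrt hn'.le]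
          rw [e]
          field_simp
  rw [hsplit, hlam]
  exact (norm_sub_le _ _).trans
    (add_le_add (norm_gradient_step_sub_le hαβ hη0.le hlow hup _ _) herr)
end
end

section
/- (Lemma 1) Let 0 < α ≤ β, σ ∈ (0,1), and 0 < η < 1/β. Let λ = max(|1 − αη|, |1 − βη|) and let G(η) be the 3×3 real matrix with rows (σ + βη, β(ηβ + 2), ηβ²), (η, σ, 0), (0, ηβ, λ). Then the spectral radius satisfies ρ(G(η)) ≤ max(1 − αη/2, σ + 5√(ηβ)·√(β/α)). In particular, when η = (α/β²)·((1−σ)/6)², one has ρ(G(η)) ≤ 1 − (1/2)·((α/β)·(1−σ)/6)² < 1. -/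
open scoped BigOperators
open Filter

noncomputable section

/-- Spectral radius of a square real matrix: the maximum modulus of its complex
eigenvalues. -/
def specRad {k : ℕ} (M : Matrix (Fin k) (Fin k) ℝ) : ℝ :=
  (spectralRadius ℂ (M.map (algebraMap ℝ ℂ))).toReal

/-- Collatz–Wielandt bound: an entrywise nonnegative matrix `M` with `M v ≤ t v` for some
positive vector `v` has spectral radius at most `t`. -/
theorem specRad_le_of_mulVec_le {k : ℕ} {M : Matrix (Fin k) (Fin k) ℝ} {v : Fin k → ℝ} {t : ℝ}
    (hM : ∀ i j, 0 ≤ M i j) (hv : ∀ i, 0 < v i) (ht : 0 ≤ t)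
    (h : ∀ i, (M.mulVec v) i ≤ t * v i) : specRad M ≤ t := by
  refine ENNReal.toReal_le_of_le_ofReal ht (iSup₂_le fun μ hμ => ?_)
  change ‖μ‖ₑ ≤ _
  rw [← ofReal_norm]
  refine ENNReal.ofReal_le_ofReal ?_
  rw [← Matrix.spectrum_toLin', ← Module.End.hasEigenvalue_iff_mem_spectrum] at hμ
  obtain ⟨u, hu⟩ := hμ.exists_hasEigenvector
  have hMu := hu.apply_eq_smul
  rw [Matrix.toLin'_apply] at hMu
  obtain ⟨j, hj⟩ := Function.ne_iff.mp hu.2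
  have : Nonempty (Fin k) := ⟨j⟩
  obtain ⟨i, hi⟩ := Finite.exists_max fun i => ‖u i‖ / v i
  have hc : 0 < ‖u i‖ / v i := (div_pos (norm_pos_iff.mpr hj) (hv j)).trans_le (hi j)
  have hui : ‖u i‖ = ‖u i‖ / v i * v i := (div_mul_cancel₀ _ (hv i).ne').symm
  refine le_of_mul_le_mul_right ?_ (mul_pos hc (hv i))
  calc ‖μ‖ * (‖u i‖ / v i * v i) = ‖∑ j, (M i j : ℂ) * u j‖ := by
        rw [← hui, ← norm_mul]
        exact congrArg norm (congrFun hMu i).symm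
    _ ≤ ∑ j, M i j * (‖u i‖ / v i * v j) := by
        refine norm_sum_le_of_le _ fun j _ => ?_
        rw [norm_mul, Complex.norm_real, Real.norm_of_nonneg (hM i j)]
        exact mul_le_mul_of_nonneg_left ((div_le_iff₀ (hv j)).mp (hi j)) (hM i j)
    _ = ‖u i‖ / v i * (M.mulVec v) i := by
        simp only [Matrix.mulVec, dotProduct, Finset.mul_sum]
        exact Finset.sum_congr rfl fun j _ => by ring
    _ ≤ ‖u i‖ / v i * (t * v i) := mul_le_mul_of_nonneg_left (h i) hc.le
    _ = t * (‖u i‖ / v i * v i) := by ring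

theorem statement10
    (α β σ η : ℝ)
    (hα : 0 < α) (hαβ : α ≤ β)
    (hσ0 : 0 < σ) (hσ1 : σ < 1)
    (hη0 : 0 < η) (hη1 : η < 1 / β)
    (lam : ℝ) (hlam : lam = max |1 - α * η| |1 - β * η|)
    (G : Matrix (Fin 3) (Fin 3) ℝ)
    (hG : G = !![σ + β * η, β * (η * β + 2), η * β ^ 2;
                 η,         σ,               0;
                 0,         η * β,           lam]) :
    specRad G ≤ max (1 - α * η / 2) (σ + 5 * Real.sqrt (η * β) * Real.sqrt (β / α)) ∧
    (η = α / β ^ 2 * ((1 - σ) / 6) ^ 2 →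
      specRad G ≤ 1 - 1 / 2 * (α / β * ((1 - σ) / 6)) ^ 2 ∧
      1 - 1 / 2 * (α / β * ((1 - σ) / 6)) ^ 2 < 1) := by
  have hβ : 0 < β := hα.trans_le hαβ
  have hx1 : η * β < 1 := (lt_div_iff₀ hβ).mp hη1
  have haβ : α * η ≤ η * β := by nlinarith
  have hlam' : lam = 1 - α * η := by
    rw [hlam, abs_of_nonneg (by linarith), abs_of_nonneg (by linarith), max_eq_left (by linarith)]
  have hbound : specRad G ≤
      max (1 - α * η / 2) (σ + 5 * Real.sqrt (η * β) * Real.sqrt (β / α)) := by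
    set t := max (1 - α * η / 2) (σ + 5 * Real.sqrt (η * β) * Real.sqrt (β / α)) with ht
    have ht1 : 1 - α * η / 2 ≤ t := le_max_left _ _
    have ht2 : σ + 5 * Real.sqrt (η * β) * Real.sqrt (β / α) ≤ t := le_max_right _ _
    clear_value t
    have hr0 : 0 < Real.sqrt (η * β) := Real.sqrt_pos.mpr (by positivity)
    have hr2 : Real.sqrt (η * β) ^ 2 = η * β := Real.sq_sqrt (by positivity)
    have hq1 : 1 ≤ Real.sqrt (β / α) := Real.one_le_sqrt.mpr ((one_le_div hα).mpr hαβ)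
    have hq2 : Real.sqrt (β / α) ^ 2 = β / α := Real.sq_sqrt (by positivity)
    generalize Real.sqrt (η * β) = r at *
    generalize Real.sqrt (β / α) = q at *
    have hq0 : 0 < q := by linarith
    have hqα : q ^ 2 * α = β := by rw [hq2, div_mul_cancel₀ _ hα.ne']
    have hr1 : r < 1 := by nlinarith
    have hrq : r * r ≤ r * q := mul_le_mul_of_nonneg_left (by linarith) hr0.le
    refine specRad_le_of_mulVec_le (v := ![5 * q / r, 1 / β, 2 * q ^ 2 / β]) ?_ ?_
      (by linarith) ?_
    · intro i j
      have hlam0 : 0 ≤ lam := by linarith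
      subst hG
      fin_cases i <;> fin_cases j <;> simp <;> positivity
    · intro i
      fin_cases i <;> simp <;> positivity
    · intro i
      subst hG
      fin_cases i <;> simp [Matrix.mulVec, dotProduct, Fin.sum_univ_three]
      · have h1 : 4 * r * q * (5 * q / r) ≤ (t - σ - β * η) * (5 * q / r) :=
          mul_le_mul_of_nonneg_right (by nlinarith) (by positivity)
        have h2 : 4 * r * q * (5 * q / r) = 20 * q ^ 2 := by field_simp; norm_num
        have h3 : β * (η * β + 2) * β⁻¹ = η * β + 2 := by field_simp
        have h4 : η * β ^ 2 * (2 * q ^ 2 / β) = 2 * (η * β) * q ^ 2 := by field_simp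
        rw [h3, h4]
        nlinarith
      · have h1 : η * (5 * q / r) = 5 * r * q * β⁻¹ := by
          field_simp
          linarith
        rw [h1, ← add_mul]
        exact mul_le_mul_of_nonneg_right (by linarith) (by positivity)
      · have h1 : η * β * β⁻¹ = (α * η / 2) * (2 * q ^ 2 / β) := by
          field_simp
          linarith
        rw [h1, ← add_mul]
        exact mul_le_mul_of_nonneg_right (by linarith) (by positivity)
  refine ⟨hbound, fun hη => ?_⟩
  have hp : 0 < (1 - σ) / 6 := by linarith
  have hab : α / β ≤ 1 := (div_le_one hβ).mpr hαβ
  have hsqrt : Real.sqrt (η * β) * Real.sqrt (β / α) = (1 - σ) / 6 := by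
    rw [← Real.sqrt_mul (by positivity),
      show η * β * (β / α) = ((1 - σ) / 6) ^ 2 by rw [hη]; field_simp,
      Real.sqrt_sq hp.le]
  have hαη : α * η / 2 = 1 / 2 * (α / β * ((1 - σ) / 6)) ^ 2 := by rw [hη]; field_simp
  have hpos : 0 < α / β * ((1 - σ) / 6) := by positivity
  have hle : α / β * ((1 - σ) / 6) ≤ (1 - σ) / 6 := mul_le_of_le_one_left hp.le hab
  refine ⟨hbound.trans (max_le (by rw [hαη]) ?_), by nlinarith⟩
  rw [mul_assoc, hsqrt]
  nlinarith
end
end
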